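/- arXiv:1907.10792 — 8 statements merged into one kernel-verified Lean document; each statement's English description precedes it below -/
import Mathlib

section
/- Let 0 ≤ a ≤ b with F̄(a) ≥ F̄(b) > 0, and suppose the SERPT ranks satisfy r_S(a) ≤ r_S(b) (as holds in particular whenever b is a hill age of the M-SERPT rank function and a ≤ b). Then h(a)/h(b) ≤ 1/(1 − ρ + ρ·F̄(b)/F̄(a)). -/
open MeasureTheory Set

/-- For `0 ≤ a ≤ b` with `F̄(a) ≥ F̄(b) > 0` and SERPT ranks satisfying
`r_S(a) ≤ r_S(b)`, we have `h(a)/h(b) ≤ 1/(1 − ρ + ρ·F̄(b)/F̄(a))`. -/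
theorem stmt0
    (F : ℝ → ℝ) (lam rho : ℝ) (h rS : ℝ → ℝ)
    (hF_cont : Continuous F)
    (hF_anti : Antitone F)
    (hF_nonneg : ∀ t, 0 ≤ F t)
    (hF_le_one : ∀ t, F t ≤ 1)
    (hF_int : IntegrableOn F (Ioi 0))
    (hmean_pos : 0 < ∫ t in Ioi (0:ℝ), F t)
    (hlam : 0 < lam)
    (hrho_def : rho = lam * ∫ t in Ioi (0:ℝ), F t)
    (hrho_lt : rho < 1)
    (hh_def : ∀ a, h a = 1 - lam * ∫ t in (0:ℝ)..a, F t)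
    (hrS_def : ∀ a, rS a = (∫ t in Ioi a, F t) / F a)
    (a b : ℝ) (ha : 0 ≤ a) (hab : a ≤ b)
    (hFb_pos : 0 < F b)
    (hFab : F b ≤ F a)
    (hrank : rS a ≤ rS b) :
    h a / h b ≤ 1 / (1 - rho + rho * (F b / F a)) := by
  have hsplit : ∀ c, 0 ≤ c →
      (∫ t in (0:ℝ)..c, F t) + ∫ t in Ioi c, F t = ∫ t in Ioi (0:ℝ), F t := fun c hc =>
    intervalIntegral.integral_interval_add_Ioi hF_int (hF_int.mono_set (Ioi_subset_Ioi hc))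
  have hFa_pos : 0 < F a := hFb_pos.trans_le hFab
  have hA_nonneg : 0 ≤ ∫ t in (0:ℝ)..a, F t :=
    intervalIntegral.integral_nonneg ha fun t _ => hF_nonneg t
  have hDb_nonneg : 0 ≤ ∫ t in Ioi b, F t := integral_nonneg fun t => hF_nonneg t
  have hrho_pos : 0 < rho := hrho_def ▸ mul_pos hlam hmean_pos
  have hsa := hsplit a ha
  have hsb := hsplit b (ha.trans hab)
  rw [hrS_def, hrS_def, div_le_div_iff₀ hFa_pos hFb_pos] at hrank
  have hx_pos : 0 < F b / F a := div_pos hFb_pos hFa_pos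
  have hx_le : F b / F a ≤ 1 := (div_le_one hFa_pos).2 hFab
  have hD : (∫ t in Ioi a, F t) * (F b / F a) ≤ ∫ t in Ioi b, F t := by
    rwa [mul_div_assoc', div_le_iff₀ hFa_pos]
  generalize F b / F a = x at *
  have ha_eq : h a = 1 - rho + lam * ∫ t in Ioi a, F t := by
    rw [hh_def, hrho_def, ← hsa]; ring
  have hb_eq : h b = 1 - rho + lam * ∫ t in Ioi b, F t := by
    rw [hh_def, hrho_def, ← hsb]; ring
  have hu : lam * ∫ t in Ioi a, F t ≤ rho := by
    rw [hrho_def]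
    exact mul_le_mul_of_nonneg_left (by linarith) hlam.le
  have hlamD := mul_le_mul_of_nonneg_left hD hlam.le
  have hhb_pos : 0 < h b := by
    rw [hb_eq]; linarith [mul_nonneg hlam.le hDb_nonneg]
  rw [div_le_div_iff₀ hhb_pos (by linarith [mul_pos hrho_pos hx_pos]), ha_eq, hb_eq]
  -- The gap is `(1 - ρ) (1 - x) (ρ - lam * ∫ t in Ioi a, F t)` plus the slack in the rank inequality.
  linarith [mul_nonneg (mul_nonneg (sub_nonneg.2 hrho_lt.le) (sub_nonneg.2 hx_le))
    (sub_nonneg.2 hu)]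
end

section
/- Let 0 ≤ a ≤ b with F̄(a) ≥ F̄(b) > 0, and suppose the SERPT ranks satisfy r_S(a) ≤ r_S(b) (as holds in particular whenever b is a hill age of the M-SERPT rank function and a ≤ b). Then h(a)/h(b) ≤ F̄(a)/F̄(b). -/
open MeasureTheory Set

/-- For `0 ≤ a ≤ b` with `F̄(a) ≥ F̄(b) > 0` and SERPT ranks satisfying
`r_S(a) ≤ r_S(b)`, we have `h(a)/h(b) ≤ F̄(a)/F̄(b)`. -/
theorem stmt1
    (F : ℝ → ℝ) (lam rho : ℝ) (h rS : ℝ → ℝ)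
    (hF_cont : Continuous F)
    (hF_anti : Antitone F)
    (hF_nonneg : ∀ t, 0 ≤ F t)
    (hF_le_one : ∀ t, F t ≤ 1)
    (hF_int : IntegrableOn F (Ioi 0))
    (hmean_pos : 0 < ∫ t in Ioi (0:ℝ), F t)
    (hlam : 0 < lam)
    (hrho_def : rho = lam * ∫ t in Ioi (0:ℝ), F t)
    (hrho_lt : rho < 1)
    (hh_def : ∀ a, h a = 1 - lam * ∫ t in (0:ℝ)..a, F t)
    (hrS_def : ∀ a, rS a = (∫ t in Ioi a, F t) / F a)
    (a b : ℝ) (ha : 0 ≤ a) (hab : a ≤ b)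
    (hFb_pos : 0 < F b)
    (hFab : F b ≤ F a)
    (hrank : rS a ≤ rS b) :
    h a / h b ≤ F a / F b := by
  have tail_eq : ∀ x, 0 ≤ x → h x = 1 - rho + lam * ∫ t in Ioi x, F t := by
    intro x hx
    have split := intervalIntegral.integral_interval_add_Ioi hF_int
      (hF_int.mono_set (Ioi_subset_Ioi hx))
    rw [hh_def, hrho_def, ← split]
    ring
  have hFa_pos : 0 < F a := hFb_pos.trans_le hFab
  have tail_nonneg : 0 ≤ ∫ t in Ioi b, F t := integral_nonneg hF_nonneg
  have hhb_pos : 0 < h b := by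
    rw [tail_eq b (ha.trans hab)]
    linarith [mul_nonneg hlam.le tail_nonneg]
  rw [hrS_def, hrS_def, div_le_div_iff₀ hFa_pos hFb_pos] at hrank
  rw [div_le_div_iff₀ hhb_pos hFb_pos, tail_eq a ha, tail_eq b (ha.trans hab)]
  linarith [mul_le_mul_of_nonneg_left hrank hlam.le,
    mul_le_mul_of_nonneg_left hFab (sub_pos.mpr hrho_lt).le]
end

section
/- Suppose F̄ is continuously differentiable with everywhere positive values, continuous density f = −F̄′, and that the hazard rate f/F̄ and the SERPT rank function r_S are piecewise monotonic. Then every hill age of the Gittins rank function r_G is also a hill age of the SERPT rank function r_S (equivalently, of the M-SERPT rank function), and every hill size of r_G is a hill size of r_S. -/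
open MeasureTheory Set

/-- Increasing envelope of a rank function: `R(a) = sup_{0 ≤ b ≤ a} r(b)`. -/
noncomputable def incEnvelope (r : ℝ → ℝ) (a : ℝ) : ℝ := sSup (r '' Icc 0 a)

/-- An age `a > 0` is a valley age of `r` if the increasing envelope of `r` is
locally constant around `a`. -/
def IsValleyAge (r : ℝ → ℝ) (a : ℝ) : Prop :=
  0 < a ∧ ∃ ε > 0, ∀ b ∈ Ioo (a - ε) (a + ε), incEnvelope r b = incEnvelope r a

/-- A hill age is a nonnegative age that is not a valley age (`0` is always a hill age). -/
def IsHillAge (r : ℝ → ℝ) (a : ℝ) : Prop := 0 ≤ a ∧ ¬ IsValleyAge r a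

/-- Previous hill age `y(x) = sup {a < x : a hill age}` (equals `0` when `x = 0`). -/
noncomputable def prevHill (r : ℝ → ℝ) (x : ℝ) : ℝ := sSup {a | a < x ∧ IsHillAge r a}

/-- Next hill age `z(x) = inf {a ≥ x : a hill age}`. -/
noncomputable def nextHill (r : ℝ → ℝ) (x : ℝ) : ℝ := sInf {a | x ≤ a ∧ IsHillAge r a}

/-- A hill size is a size `x` with `y(x) = x = z(x)`. -/
def IsHillSize (r : ℝ → ℝ) (x : ℝ) : Prop := prevHill r x = x ∧ nextHill r x = x

/-- SERPT rank function: `r_S(a) = (∫_a^∞ F̄)/F̄(a)`. -/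
noncomputable def serptRank (F : ℝ → ℝ) (a : ℝ) : ℝ := (∫ t in Ioi a, F t) / F a

/-- Efficiency function `η(a,b) = (∫_a^b F̄)/(F̄(a) − F̄(b))`. -/
noncomputable def effFn (F : ℝ → ℝ) (a b : ℝ) : ℝ := (∫ t in a..b, F t) / (F a - F b)

/-- Gittins rank function: `r_G(a) = inf {η(a,b) : b ∈ (a,∞], F̄(b) < F̄(a)}`,
where the choice `b = ∞` gives `η(a,∞) = r_S(a)`. -/
noncomputable def gittinsRank (F : ℝ → ℝ) (a : ℝ) : ℝ :=
  sInf (insert (serptRank F a) {x | ∃ b, a < b ∧ F b < F a ∧ x = effFn F a b})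

/-- A function `g : ℝ → ℝ` is piecewise monotonic: every compact interval admits a
finite partition on whose pieces `g` is monotone. -/
def PiecewiseMonotone (g : ℝ → ℝ) : Prop :=
  ∀ a b : ℝ, a ≤ b → ∃ (n : ℕ) (p : ℕ → ℝ), p 0 = a ∧ p n = b ∧
    (∀ i < n, p i ≤ p (i + 1)) ∧
    ∀ i < n, MonotoneOn g (Icc (p i) (p (i + 1))) ∨ AntitoneOn g (Icc (p i) (p (i + 1)))

theorem le_incEnvelope {r : ℝ → ℝ} {a b : ℝ} (hr : BddAbove (r '' Icc 0 a))
    (hb : 0 ≤ b) (hba : b ≤ a) : r b ≤ incEnvelope r a :=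
  le_csSup hr ⟨b, ⟨hb, hba⟩, rfl⟩

/-- The age `0` is always a hill age. -/
theorem isHillAge_zero (r : ℝ → ℝ) : IsHillAge r 0 :=
  ⟨le_rfl, fun h => lt_irrefl _ h.1⟩

theorem isHillSize_of_isHillAge_imp {r s : ℝ → ℝ} (h : ∀ a, IsHillAge r a → IsHillAge s a)
    {x : ℝ} (hx : IsHillSize r x) : IsHillSize s x := by
  obtain ⟨hy, hz⟩ := hx
  constructor
  · rcases {a | a < x ∧ IsHillAge r a}.eq_empty_or_nonempty with he | hne
    · have hx0 : x = 0 := by rw [← hy, prevHill, he, Real.sSup_empty]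
      subst hx0
      have hs : {a | a < 0 ∧ IsHillAge s a} = ∅ := by
        ext a
        simpa using fun ha (hs : IsHillAge s a) => absurd hs.1 (not_le.2 ha)
      rw [prevHill, hs, Real.sSup_empty]
    · have hsub : {a | a < x ∧ IsHillAge r a} ⊆ {a | a < x ∧ IsHillAge s a} :=
        fun a ha => ⟨ha.1, h a ha.2⟩
      refine le_antisymm (csSup_le (hne.mono hsub) fun a ha => ha.1.le) ?_
      exact hy.symm.le.trans (csSup_le_csSup ⟨x, fun a ha => ha.1.le⟩ hne hsub)
  · have hne : {a | x ≤ a ∧ IsHillAge r a}.Nonempty := by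
      rcases {a | x ≤ a ∧ IsHillAge r a}.eq_empty_or_nonempty with he | hne
      · have hx0 : x = 0 := by rw [← hz, nextHill, he, Real.sInf_empty]
        exact ⟨0, hx0.le, isHillAge_zero r⟩
      · exact hne
    have hsub : {a | x ≤ a ∧ IsHillAge r a} ⊆ {a | x ≤ a ∧ IsHillAge s a} :=
      fun a ha => ⟨ha.1, h a ha.2⟩
    refine le_antisymm ?_ (le_csInf (hne.mono hsub) fun a ha => ha.1)
    exact (csInf_le_csInf ⟨x, fun a ha => ha.1⟩ hne hsub).trans hz.le

section Gittins

variable {F : ℝ → ℝ}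

theorem integrableOn_Ioi_of_nonneg_left (hF_int : IntegrableOn F (Ioi 0)) {a : ℝ} (ha : 0 ≤ a) :
    IntegrableOn F (Ioi a) := hF_int.mono_set (Ioi_subset_Ioi ha)

theorem intervalIntegral_eq_tail_sub_tail (hF_int : IntegrableOn F (Ioi 0)) {a b : ℝ}
    (ha : 0 ≤ a) (hb : 0 ≤ b) :
    ∫ t in a..b, F t = (∫ t in Ioi a, F t) - ∫ t in Ioi b, F t :=
  (intervalIntegral.integral_Ioi_sub_Ioi' (integrableOn_Ioi_of_nonneg_left hF_int ha)
    (integrableOn_Ioi_of_nonneg_left hF_int hb)).symm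

theorem continuousOn_tail (hF_cont : Continuous F) (hF_int : IntegrableOn F (Ioi 0)) :
    ContinuousOn (fun a => ∫ t in Ioi a, F t) (Ici 0) := by
  have hc : Continuous fun a => (∫ t in Ioi (0 : ℝ), F t) - ∫ t in (0 : ℝ)..a, F t :=
    continuous_const.sub
      (intervalIntegral.continuous_primitive (fun a b => hF_cont.intervalIntegrable a b) 0)
  refine hc.continuousOn.congr fun a ha => ?_
  have := intervalIntegral_eq_tail_sub_tail hF_int le_rfl ha
  simp only
  linarith

theorem effFn_nonneg (hF_pos : ∀ t, 0 < F t) {a b : ℝ} (hab : a < b) (hlt : F b < F a) :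
    0 ≤ effFn F a b :=
  div_nonneg (intervalIntegral.integral_nonneg hab.le fun t _ => (hF_pos t).le)
    (sub_nonneg.2 hlt.le)

theorem serptRank_nonneg (hF_pos : ∀ t, 0 < F t) (a : ℝ) : 0 ≤ serptRank F a :=
  div_nonneg (integral_nonneg fun t => (hF_pos t).le) (hF_pos a).le

theorem bddBelow_efficiencies (hF_pos : ∀ t, 0 < F t) (a : ℝ) :
    BddBelow (insert (serptRank F a) {x | ∃ b, a < b ∧ F b < F a ∧ x = effFn F a b}) := by
  refine ⟨0, ?_⟩
  rintro x (rfl | ⟨b, hab, hlt, rfl⟩)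
  exacts [serptRank_nonneg hF_pos a, effFn_nonneg hF_pos hab hlt]

theorem gittinsRank_le_serptRank (hF_pos : ∀ t, 0 < F t) (a : ℝ) :
    gittinsRank F a ≤ serptRank F a :=
  csInf_le (bddBelow_efficiencies hF_pos a) (mem_insert _ _)

/-- An age `a` has Gittins rank at least `r` exactly when `a` maximises
`b ↦ ∫_b^∞ F - r F(b)` over `[a, ∞]`, the value at `∞` being `0`. -/
theorem le_gittinsRank_iff (hF_anti : Antitone F) (hF_pos : ∀ t, 0 < F t)
    (hF_int : IntegrableOn F (Ioi 0)) {a r : ℝ} (ha : 0 ≤ a) :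
    r ≤ gittinsRank F a ↔ 0 ≤ (∫ t in Ioi a, F t) - r * F a ∧
      ∀ b, a < b → (∫ t in Ioi b, F t) - r * F b ≤ (∫ t in Ioi a, F t) - r * F a := by
  rw [gittinsRank, le_csInf_iff (bddBelow_efficiencies hF_pos a) (insert_nonempty _ _)]
  have hserpt : r ≤ serptRank F a ↔ 0 ≤ (∫ t in Ioi a, F t) - r * F a := by
    rw [serptRank, le_div_iff₀ (hF_pos a), sub_nonneg]
  have heff : ∀ b, a < b → F b < F a → (r ≤ effFn F a b ↔
      (∫ t in Ioi b, F t) - r * F b ≤ (∫ t in Ioi a, F t) - r * F a) := by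
    intro b hab hlt
    rw [effFn, le_div_iff₀ (sub_pos.2 hlt),
      intervalIntegral_eq_tail_sub_tail hF_int ha (ha.trans hab.le)]
    constructor <;> intro h <;> linarith
  constructor
  · intro h
    refine ⟨hserpt.1 (h _ (mem_insert _ _)), fun b hab => ?_⟩
    rcases (hF_anti hab.le).lt_or_eq with hlt | heq
    · exact (heff b hab hlt).1 (h _ (mem_insert_of_mem _ ⟨b, hab, hlt, rfl⟩))
    · have hint := intervalIntegral_eq_tail_sub_tail hF_int ha (ha.trans hab.le)
      have hnn : 0 ≤ ∫ t in a..b, F t :=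
        intervalIntegral.integral_nonneg hab.le fun t _ => (hF_pos t).le
      rw [heq]
      linarith
  · rintro ⟨h0, hb⟩ x (rfl | ⟨b, hab, hlt, rfl⟩)
    exacts [hserpt.2 h0, (heff b hab hlt).2 (hb b hab)]

theorem continuousOn_serptRank (hF_cont : Continuous F) (hF_pos : ∀ t, 0 < F t)
    (hF_int : IntegrableOn F (Ioi 0)) : ContinuousOn (serptRank F) (Ici 0) :=
  (continuousOn_tail hF_cont hF_int).div hF_cont.continuousOn fun a _ => (hF_pos a).ne'

theorem bddAbove_serptRank_image (hF_cont : Continuous F) (hF_pos : ∀ t, 0 < F t)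
    (hF_int : IntegrableOn F (Ioi 0)) (a : ℝ) : BddAbove (serptRank F '' Icc 0 a) :=
  isCompact_Icc.bddAbove_image
    ((continuousOn_serptRank hF_cont hF_pos hF_int).mono Icc_subset_Ici_self)

theorem bddAbove_gittinsRank_image (hF_cont : Continuous F) (hF_pos : ∀ t, 0 < F t)
    (hF_int : IntegrableOn F (Ioi 0)) (a : ℝ) : BddAbove (gittinsRank F '' Icc 0 a) := by
  obtain ⟨C, hC⟩ := bddAbove_serptRank_image hF_cont hF_pos hF_int a
  refine ⟨C, ?_⟩
  rintro _ ⟨b, hb, rfl⟩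
  exact (gittinsRank_le_serptRank hF_pos b).trans (hC ⟨b, hb, rfl⟩)

/-- If the SERPT rank on `[c, x]` is maximal at `c`, then any bound for the Gittins rank on some
`[c, b]` with `c ≤ b ≤ x` also bounds the Gittins rank at `x`. -/
theorem gittinsRank_le_of_serptRank_le (hF_cont : Continuous F) (hF_anti : Antitone F)
    (hF_pos : ∀ t, 0 < F t) (hF_int : IntegrableOn F (Ioi 0)) {b c s x : ℝ} (hc : 0 ≤ c)
    (hcb : c ≤ b) (hbx : b ≤ x) (hmax : ∀ y ∈ Icc c x, serptRank F y ≤ serptRank F c)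
    (hs : ∀ y ∈ Icc c b, gittinsRank F y ≤ s) : gittinsRank F x ≤ s := by
  by_contra! hlt
  obtain ⟨r, hsr, hrx⟩ := exists_between hlt
  have hcx : c ≤ x := hcb.trans hbx
  set g : ℝ → ℝ := fun a => (∫ t in Ioi a, F t) - r * F a with hg
  have hserpt : ∀ a, serptRank F a = r + g a / F a := by
    intro a
    have := (hF_pos a).ne'
    simp only [hg, serptRank]
    field_simp
    ring
  have hgcont : ContinuousOn g (Icc c x) :=
    ((continuousOn_tail hF_cont hF_int).sub
      (continuous_const.mul hF_cont).continuousOn).mono fun a ha => hc.trans ha.1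
  obtain ⟨d, hd, hdmax⟩ := isCompact_Icc.exists_isMaxOn (nonempty_Icc.2 hcx) hgcont
  have hdmax : ∀ y ∈ Icc c x, g y ≤ g d := hdmax
  have hgx := (le_gittinsRank_iff hF_anti hF_pos hF_int (hc.trans hcx)).1 hrx.le
  have hmaxd : ∀ y, c ≤ y → g y ≤ g d := by
    intro y hy
    rcases le_or_gt y x with h | h
    · exact hdmax y ⟨hy, h⟩
    · exact (hgx.2 y h).trans (hdmax x ⟨hcx, le_rfl⟩)
  have hgc : 0 < g c := by
    have h1 : r < serptRank F c :=
      (hrx.trans_le (gittinsRank_le_serptRank hF_pos x)).trans_le (hmax x ⟨hcx, le_rfl⟩)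
    rw [hserpt] at h1
    exact (div_pos_iff_of_pos_right (hF_pos c)).1 (by linarith)
  have hgcd : g c < g d := by
    by_contra! h
    have : r ≤ gittinsRank F c := (le_gittinsRank_iff hF_anti hF_pos hF_int hc).2
      ⟨hgc.le, fun y hy => (hmaxd y hy.le).trans h⟩
    exact absurd (hs c ⟨le_rfl, hcb⟩) (by linarith)
  have hle := hmax d hd
  rw [hserpt, hserpt] at hle
  have h1 : g c / F c ≤ g c / F d :=
    div_le_div_of_nonneg_left hgc.le (hF_pos d) (hF_anti hd.1)
  have h2 : g c / F d < g d / F d := div_lt_div_of_pos_right hgcd (hF_pos d)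
  linarith

theorem IsValleyAge.gittinsRank_of_serptRank (hF_cont : Continuous F) (hF_anti : Antitone F)
    (hF_pos : ∀ t, 0 < F t) (hF_int : IntegrableOn F (Ioi 0)) {a : ℝ}
    (h : IsValleyAge (serptRank F) a) : IsValleyAge (gittinsRank F) a := by
  obtain ⟨ha, ε, hε, hconst⟩ := h
  have hSbdd := bddAbove_serptRank_image hF_cont hF_pos hF_int
  have hGbdd := bddAbove_gittinsRank_image hF_cont hF_pos hF_int
  set δ := min (ε / 2) a with hδ_def
  have hδ : 0 < δ := lt_min (half_pos hε) ha
  have hδε : δ < ε := (min_le_left _ _).trans_lt (half_lt_self hε)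
  have hδa : 0 ≤ a - δ := sub_nonneg.2 (min_le_right _ _)
  obtain ⟨c, hc, hcsup⟩ := isCompact_Icc.exists_sSup_image_eq (nonempty_Icc.2 hδa)
    ((continuousOn_serptRank hF_cont hF_pos hF_int).mono Icc_subset_Ici_self)
  have hmax : ∀ y, 0 ≤ y → y < a + δ → serptRank F y ≤ serptRank F c := by
    intro y hy0 hy
    have h1 := hconst (a - δ) ⟨by linarith, by linarith⟩
    have h2 := hconst (max y a) ⟨by linarith [le_max_right y a],
      max_lt (by linarith) (by linarith)⟩
    rw [← hcsup]
    exact (le_incEnvelope (hSbdd _) hy0 (le_max_left _ _)).trans (h2.trans h1.symm).le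
  have hle : ∀ b ∈ Ioo (a - δ) (a + δ), ∀ b' ∈ Ioo (a - δ) (a + δ),
      incEnvelope (gittinsRank F) b' ≤ incEnvelope (gittinsRank F) b := by
    intro b hb b' hb'
    refine csSup_le ⟨_, 0, ⟨le_rfl, hδa.trans hb'.1.le⟩, rfl⟩ ?_
    rintro _ ⟨x, hx, rfl⟩
    rcases le_or_gt x b with hxb | hbx
    · exact le_incEnvelope (hGbdd b) hx.1 hxb
    · exact gittinsRank_le_of_serptRank_le hF_cont hF_anti hF_pos hF_int hc.1
        (hc.2.trans hb.1.le) hbx.le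
        (fun y hy => hmax y (hc.1.trans hy.1) ((hy.2.trans hx.2).trans_lt hb'.2))
        (fun y hy => le_incEnvelope (hGbdd b) (hc.1.trans hy.1) hy.2)
  have ha_mem : a ∈ Ioo (a - δ) (a + δ) := ⟨by linarith, by linarith⟩
  exact ⟨ha, δ, hδ, fun b hb => le_antisymm (hle a ha_mem b hb) (hle b hb a ha_mem)⟩

end Gittins

/-- every Gittins hill age is a SERPT (equivalently M-SERPT) hill age,
and every Gittins hill size is a SERPT hill size. -/
theorem stmt2
    (F : ℝ → ℝ) (lam rho : ℝ)
    (hF_diff : ContDiff ℝ 1 F)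
    (hF_anti : Antitone F)
    (hF_pos : ∀ t, 0 < F t)
    (hF_le_one : ∀ t, F t ≤ 1)
    (hF_int : IntegrableOn F (Ioi 0))
    (hmean_pos : 0 < ∫ t in Ioi (0:ℝ), F t)
    (hlam : 0 < lam)
    (hrho_def : rho = lam * ∫ t in Ioi (0:ℝ), F t)
    (hrho_lt : rho < 1)
    (hhaz_pm : PiecewiseMonotone (fun t => (-deriv F t) / F t))
    (hserpt_pm : PiecewiseMonotone (serptRank F)) :
    (∀ a, IsHillAge (gittinsRank F) a → IsHillAge (serptRank F) a) ∧
    (∀ x, 0 ≤ x → IsHillSize (gittinsRank F) x → IsHillSize (serptRank F) x) := by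
  have hF_cont := hF_diff.continuous
  have hage : ∀ a, IsHillAge (gittinsRank F) a → IsHillAge (serptRank F) a := fun a ha =>
    ⟨ha.1, fun hv => ha.2 (hv.gittinsRank_of_serptRank hF_cont hF_anti hF_pos hF_int)⟩
  exact ⟨hage, fun x _ hx => isHillSize_of_isHillAge_imp hage hx⟩
end

section
/- Suppose F̄ is continuously differentiable with continuous density f = −F̄′, and let u < v be hill ages of the SERPT rank function r_S with F̄(v) > 0, such that the interval (u, v] decomposes into finitely many maximal hills and valleys of r_S. Let y(x) and z(x) denote the previous and next hill ages of x with respect to r_S. Then ∫_u^v [ h(u)·h(v) / (h(y(x))·h(z(x))) ] · f(x) dx ≤ (2/(1 + √(1−ρ))) · (F̄(u) − F̄(v)). -/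
open MeasureTheory Set

/-- The interval `(u, v]` decomposes into finitely many hills and valleys of `r`:
there is a finite partition of `[u, v]` by hill ages such that each piece consists
entirely of hill sizes (a hill) or has no hill sizes in its interior (a valley). -/
def FiniteHillValleyDecomp (r : ℝ → ℝ) (u v : ℝ) : Prop :=
  ∃ (n : ℕ) (p : ℕ → ℝ), p 0 = u ∧ p n = v ∧
    (∀ i ≤ n, IsHillAge r (p i)) ∧ (∀ i < n, p i < p (i + 1)) ∧
    ∀ i < n, (∀ x ∈ Ioc (p i) (p (i + 1)), IsHillSize r x) ∨
             (∀ x ∈ Ioo (p i) (p (i + 1)), ¬ IsHillSize r x)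


open Filter Topology

section Envelope

variable {r : ℝ → ℝ} {w : ℝ}

lemma incEnvelope_isGreatest (hr : ContinuousOn r (Icc 0 w)) {a : ℝ} (ha : 0 ≤ a) (haw : a ≤ w) :
    IsGreatest (r '' Icc 0 a) (incEnvelope r a) :=
  (isCompact_Icc.image_of_continuousOn (hr.mono (Icc_subset_Icc_right haw))).isGreatest_sSup
    ((nonempty_Icc.2 ha).image r)

lemma le_incEnvelope_s4 (hr : ContinuousOn r (Icc 0 w)) {a t : ℝ} (ht : 0 ≤ t) (hta : t ≤ a)
    (haw : a ≤ w) : r t ≤ incEnvelope r a :=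
  (incEnvelope_isGreatest hr (ht.trans hta) haw).2 ⟨t, ⟨ht, hta⟩, rfl⟩

lemma incEnvelope_mono (hr : ContinuousOn r (Icc 0 w)) {a b : ℝ} (ha : 0 ≤ a) (hab : a ≤ b)
    (hbw : b ≤ w) : incEnvelope r a ≤ incEnvelope r b := by
  obtain ⟨t, ht, hta⟩ := (incEnvelope_isGreatest hr ha (hab.trans hbw)).1
  rw [← hta]
  exact le_incEnvelope_s4 hr ht.1 (ht.2.trans hab) hbw

/-- At a hill age the rank function meets its increasing envelope. -/
lemma IsHillAge.eq_incEnvelope (hr : ContinuousOn r (Icc 0 w)) {a : ℝ} (ha : IsHillAge r a)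
    (haw : a < w) : r a = incEnvelope r a := by
  obtain ⟨ha0, hval⟩ := ha
  refine le_antisymm (le_incEnvelope_s4 hr ha0 le_rfl haw.le) ?_
  by_contra! hlt
  apply hval
  obtain ⟨b, hb, hba⟩ := (incEnvelope_isGreatest hr ha0 haw.le).1
  have hba' : b < a := lt_of_le_of_ne hb.2 (by rintro rfl; exact hlt.ne hba)
  have ha_pos : 0 < a := hb.1.trans_lt hba'
  have hev : ∀ᶠ x in 𝓝 a, r x < incEnvelope r a ∧ x < w ∧ b < x :=
    (((hr.continuousAt (Icc_mem_nhds ha_pos haw)).eventually (gt_mem_nhds hlt)).and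
      ((gt_mem_nhds haw).and (lt_mem_nhds hba')))
  obtain ⟨ε, hε, hball⟩ := Metric.eventually_nhds_iff.1 hev
  have hmem : ∀ x ∈ Ioo (a - ε) (a + ε), r x < incEnvelope r a ∧ x < w ∧ b < x := by
    intro x hx
    apply hball
    rw [Real.dist_eq, abs_lt]
    constructor <;> linarith [hx.1, hx.2]
  refine ⟨ha_pos, ε, hε, fun x hx => ?_⟩
  obtain ⟨-, hxw, hbx⟩ := hmem x hx
  refine IsGreatest.csSup_eq ⟨⟨b, ⟨hb.1, hbx.le⟩, hba⟩, ?_⟩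
  rintro _ ⟨t, ht, rfl⟩
  rcases le_or_gt t a with hta | hta
  · exact le_incEnvelope_s4 hr ht.1 hta haw.le
  · exact (hmem t ⟨by linarith, ht.2.trans_lt hx.2⟩).1.le

lemma IsHillAge.rank_mono (hr : ContinuousOn r (Icc 0 w)) {a b : ℝ} (ha : IsHillAge r a)
    (hb : IsHillAge r b) (hab : a ≤ b) (hbw : b < w) : r a ≤ r b := by
  rw [ha.eq_incEnvelope hr (hab.trans_lt hbw), hb.eq_incEnvelope hr hbw]
  exact incEnvelope_mono hr ha.1 hab hbw.le

/-- Every level strictly above the envelope at `s` and at most the envelope at `t` has a first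
hitting age in `(s, t]`. -/
lemma exists_first_hit (hr : ContinuousOn r (Icc 0 w)) {s t c : ℝ} (hs : 0 ≤ s) (hst : s ≤ t)
    (htw : t ≤ w) (hsc : incEnvelope r s < c) (hct : c ≤ incEnvelope r t) :
    ∃ α ∈ Ioc s t, r α = c ∧ ∀ b, 0 ≤ b → b < α → r b < c := by
  have hrs : r s < c := (le_incEnvelope_s4 hr hs le_rfl (hst.trans htw)).trans_lt hsc
  have hit : ∀ b ∈ Icc s t, c ≤ r b → ∃ x ∈ Icc s b, r x = c := fun b hb hcb =>
    intermediate_value_Icc hb.1 (hr.mono (Icc_subset_Icc hs (hb.2.trans htw))) ⟨hrs.le, hcb⟩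
  obtain ⟨τ, hτ, hτt⟩ := (incEnvelope_isGreatest hr (hs.trans hst) htw).1
  have hsτ : s < τ := by
    by_contra! hle
    have := le_incEnvelope_s4 hr hτ.1 hle (hst.trans htw)
    linarith
  have hne : (Icc s t ∩ r ⁻¹' {c}).Nonempty := by
    obtain ⟨x, hx, hxc⟩ := hit τ ⟨hsτ.le, hτ.2⟩ (hτt ▸ hct)
    exact ⟨x, ⟨hx.1, hx.2.trans hτ.2⟩, hxc⟩
  have hcomp : IsCompact (Icc s t ∩ r ⁻¹' {c}) :=
    isCompact_Icc.of_isClosed_subset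
      ((hr.mono (Icc_subset_Icc hs htw)).preimage_isClosed_of_isClosed isClosed_Icc
        isClosed_singleton) inter_subset_left
  obtain ⟨α, ⟨hα, hαc⟩, hmin⟩ := hcomp.exists_isLeast hne
  have hαc : r α = c := hαc
  refine ⟨α, ⟨lt_of_le_of_ne hα.1 (by rintro rfl; exact hrs.ne hαc), hα.2⟩, hαc, fun b hb hbα => ?_⟩
  by_contra! hcb
  rcases le_or_gt b s with hbs | hbs
  · have := le_incEnvelope_s4 hr hb hbs (hst.trans htw)
    linarith
  · obtain ⟨x, hx, hxc⟩ := hit b ⟨hbs.le, hbα.le.trans hα.2⟩ hcb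
    have := hmin ⟨⟨hx.1, hx.2.trans (hbα.le.trans hα.2)⟩, hxc⟩
    linarith [hx.2]

lemma isHillAge_of_first_hit (hr : ContinuousOn r (Icc 0 w)) {α : ℝ} (hα : 0 < α) (hαw : α ≤ w)
    (hlt : ∀ b, 0 ≤ b → b < α → r b < r α) : IsHillAge r α := by
  refine ⟨hα.le, ?_⟩
  rintro ⟨-, ε, hε, hconst⟩
  have hb1 : max 0 (α - ε / 2) < α := max_lt hα (by linarith)
  have hb2 : α - ε / 2 ≤ max 0 (α - ε / 2) := le_max_right _ _
  obtain ⟨t, ht, hte⟩ := (incEnvelope_isGreatest hr (le_max_left 0 (α - ε / 2))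
    (hb1.le.trans hαw)).1
  have := hlt t ht.1 (ht.2.trans_lt hb1)
  have h1 := hconst (max 0 (α - ε / 2)) ⟨by linarith, by linarith⟩
  have h2 := le_incEnvelope_s4 hr hα.le le_rfl hαw
  linarith

lemma IsHillAge.nextHill_eq {a : ℝ} (ha : IsHillAge r a) : nextHill r a = a :=
  IsLeast.csInf_eq ⟨⟨le_rfl, ha⟩, fun _ hb => hb.1⟩

/-- If `(a, b)` contains no hill size, the envelope is constant on it. -/
lemma incEnvelope_eq_of_no_hillSize (hr : ContinuousOn r (Icc 0 w)) {a b : ℝ} (ha : 0 ≤ a)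
    (hbw : b ≤ w) (hno : ∀ x ∈ Ioo a b, ¬ IsHillSize r x) {s t : ℝ} (has : a < s) (hst : s ≤ t)
    (htb : t < b) : incEnvelope r s = incEnvelope r t := by
  have hs : 0 ≤ s := ha.trans has.le
  have htw : t ≤ w := htb.le.trans hbw
  refine le_antisymm (incEnvelope_mono hr hs hst htw) ?_
  by_contra! hlt
  obtain ⟨α, hα, hαc, hαlt⟩ := exists_first_hit hr hs hst htw hlt le_rfl
  have hα0 : 0 < α := hs.trans_lt hα.1
  have hαw : α ≤ w := hα.2.trans htw
  have hhill : IsHillAge r α := isHillAge_of_first_hit hr hα0 hαw (hαc ▸ hαlt)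
  refine hno α ⟨has.trans hα.1, hα.2.trans_lt htb⟩ ⟨?_, hhill.nextHill_eq⟩
  refine csSup_eq_of_forall_le_of_forall_lt_exists_gt ?_ (fun x hx => hx.1.le) ?_
  · by_contra hne
    obtain ⟨β, hβ, hβc, hβlt⟩ := exists_first_hit hr hs hst htw
      (c := (incEnvelope r s + incEnvelope r t) / 2) (by linarith) (by linarith)
    have hβα : β < α := by
      by_contra! hle
      rcases hle.lt_or_eq with hle | rfl
      · have := hβlt α hα0.le hle
        linarith
      · linarith
    exact hne ⟨β, hβα, isHillAge_of_first_hit hr (hs.trans_lt hβ.1) (hβ.2.trans htw)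
      (hβc ▸ hβlt)⟩
  · intro x hx
    set s' := max s x
    have hs'α : s' < α := max_lt hα.1 hx
    have hs'0 : 0 ≤ s' := hs.trans (le_max_left _ _)
    have hlt' : incEnvelope r s' < r α := by
      obtain ⟨y, hy, hye⟩ := (incEnvelope_isGreatest hr hs'0 (hs'α.le.trans hαw)).1
      rw [← hye, hαc]
      exact hαlt y hy.1 (hy.2.trans_lt hs'α)
    obtain ⟨β, hβ, hβc, hβlt⟩ := exists_first_hit hr hs'0 hs'α.le hαw
      (c := (incEnvelope r s' + r α) / 2) (by linarith)
      (by linarith [le_incEnvelope_s4 hr hα0.le le_rfl hαw])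
    have hβα : β < α := lt_of_le_of_ne hβ.2 (by rintro rfl; linarith)
    exact ⟨β, ⟨hβα, isHillAge_of_first_hit hr (hs'0.trans_lt hβ.1) (hβ.2.trans hαw)
      (hβc ▸ hβlt)⟩, (le_max_right _ _).trans_lt hβ.1⟩

lemma not_isHillAge_of_no_hillSize (hr : ContinuousOn r (Icc 0 w)) {a b : ℝ} (ha : 0 ≤ a)
    (hbw : b ≤ w) (hno : ∀ x ∈ Ioo a b, ¬ IsHillSize r x) {x : ℝ} (hx : x ∈ Ioo a b) :
    ¬ IsHillAge r x := by
  refine fun hill => hill.2 ⟨ha.trans_lt hx.1, min (x - a) (b - x), ?_, fun y hy => ?_⟩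
  · exact lt_min (by linarith [hx.1]) (by linarith [hx.2])
  · have h1 := min_le_left (x - a) (b - x)
    have h2 := min_le_right (x - a) (b - x)
    rcases le_total x y with hxy | hxy
    · exact (incEnvelope_eq_of_no_hillSize hr ha hbw hno hx.1 hxy (by linarith [hy.2])).symm
    · exact incEnvelope_eq_of_no_hillSize hr ha hbw hno (by linarith [hy.1]) hxy hx.2

lemma prevHill_eq_of_gap {a b x : ℝ} (ha : IsHillAge r a) (hgap : ∀ x ∈ Ioo a b, ¬ IsHillAge r x)
    (hx : x ∈ Ioo a b) : prevHill r x = a := by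
  refine IsGreatest.csSup_eq ⟨⟨hx.1, ha⟩, fun c hc => ?_⟩
  by_contra! hlt
  exact hgap c ⟨hlt, hc.1.trans hx.2⟩ hc.2

lemma nextHill_eq_of_gap {a b x : ℝ} (hb : IsHillAge r b) (hgap : ∀ x ∈ Ioo a b, ¬ IsHillAge r x)
    (hx : x ∈ Ioo a b) : nextHill r x = b := by
  refine IsLeast.csInf_eq ⟨⟨hx.2.le, hb⟩, fun c hc => ?_⟩
  by_contra! hlt
  exact hgap c ⟨hx.1.trans_le hc.1, hlt⟩ hc.2

lemma IsHillSize.isHillAge {x b : ℝ} (hx : IsHillSize r x) (hx0 : 0 ≤ x) (hxb : x ≤ b)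
    (hb : IsHillAge r b) : IsHillAge r x := by
  refine ⟨hx0, ?_⟩
  rintro ⟨hpos, ε, hε, hconst⟩
  have hle : x + ε ≤ nextHill r x := by
    refine le_csInf ⟨b, hxb, hb⟩ fun c hc => ?_
    by_contra! hlt
    refine hc.2.2 ⟨hpos.trans_le hc.1, x + ε - c, by linarith, fun y hy => ?_⟩
    rw [hconst y ⟨by linarith [hy.1, hc.1, hx.1], by linarith [hy.2]⟩,
      hconst c ⟨by linarith [hc.1], hlt⟩]
  linarith [hx.2]

end Envelope

section Potential

/-- Lower bound, as a function of the tail mass `s`, for the truncated load complement. -/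
noncomputable def loadFloor (L k s₀ s : ℝ) : ℝ := L + k * max (s - s₀) 0

/-- A primitive of `1 / loadFloor ^ 2`. -/
noncomputable def loadPotential (L k s₀ s : ℝ) : ℝ := (s - s₀) / (L * loadFloor L k s₀ s)

variable {L k s₀ : ℝ}

lemma loadFloor_pos (hL : 0 < L) (hk : 0 ≤ k) (s : ℝ) : 0 < loadFloor L k s₀ s := by
  unfold loadFloor
  have := mul_nonneg hk (le_max_right (s - s₀) 0)
  linarith

lemma continuous_loadFloor : Continuous (loadFloor L k s₀) := by
  unfold loadFloor
  fun_prop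

lemma loadPotential_secant (hL : 0 < L) (hk : 0 ≤ k) {s t : ℝ} (hst : s ≤ t) :
    (t - s) / (loadFloor L k s₀ s * loadFloor L k s₀ t) ≤
      loadPotential L k s₀ t - loadPotential L k s₀ s := by
  have hs := loadFloor_pos (s₀ := s₀) hL hk s
  have ht := loadFloor_pos (s₀ := s₀) hL hk t
  have key : 0 ≤ (t - s₀) * max (s - s₀) 0 - (s - s₀) * max (t - s₀) 0 := by
    rcases le_total (s - s₀) 0 with h1 | h1 <;> rcases le_total (t - s₀) 0 with h2 | h2
    · simp [h1, h2]
    · rw [max_eq_right h1, max_eq_left h2]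
      nlinarith
    · rw [max_eq_left h1, max_eq_right h2]
      nlinarith
    · rw [max_eq_left h1, max_eq_left h2]
      nlinarith
  have hform : loadPotential L k s₀ t - loadPotential L k s₀ s =
      ((t - s) * L + k * ((t - s₀) * max (s - s₀) 0 - (s - s₀) * max (t - s₀) 0)) /
        (L * (loadFloor L k s₀ s * loadFloor L k s₀ t)) := by
    unfold loadPotential
    rw [div_sub_div _ _ (by positivity) (by positivity), div_eq_div_iff (by positivity)
      (by positivity)]
    simp only [loadFloor]
    ring
  rw [hform, div_le_div_iff₀ (by positivity) (by positivity)]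
  have h3 := mul_nonneg (mul_nonneg hk key) (mul_pos hs ht).le
  nlinarith

lemma hasDerivAt_loadPotential (hL : 0 < L) (hk : 0 ≤ k) (s : ℝ) :
    HasDerivAt (loadPotential L k s₀) (1 / loadFloor L k s₀ s ^ 2) s := by
  have hpos := loadFloor_pos (s₀ := s₀) hL hk
  rcases lt_trichotomy s s₀ with hs | rfl | hs
  · have hev : loadPotential L k s₀ =ᶠ[𝓝 s] fun x => (x - s₀) / (L * L) := by
      filter_upwards [gt_mem_nhds hs] with x hx
      simp [loadPotential, loadFloor, max_eq_right (sub_nonpos.2 hx.le)]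
    have hd : HasDerivAt (fun x => (x - s₀) / (L * L)) (1 / (L * L)) s :=
      ((hasDerivAt_id s).sub_const s₀).div_const _
    refine (hd.congr_of_eventuallyEq hev).congr_deriv ?_
    simp [loadFloor, max_eq_right (sub_nonpos.2 hs.le), sq]
  · rw [hasDerivAt_iff_tendsto_slope]
    have hc : Tendsto (fun x => 1 / (L * loadFloor L k s x)) (𝓝[≠] s)
        (𝓝 (1 / (L * loadFloor L k s s))) := by
      have : Continuous fun x => 1 / (L * loadFloor L k s x) :=
        continuous_const.div (continuous_const.mul continuous_loadFloor)
          fun x => (mul_pos hL (hpos x)).ne'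
      exact this.continuousAt.tendsto.mono_left nhdsWithin_le_nhds
    have hval : 1 / loadFloor L k s s ^ 2 = 1 / (L * loadFloor L k s s) := by
      simp [loadFloor, sq]
    rw [hval]
    refine hc.congr' ?_
    filter_upwards [self_mem_nhdsWithin] with x hx
    have hx' : x - s ≠ 0 := sub_ne_zero.2 hx
    have := (hpos x).ne'
    rw [slope_def_field]
    simp only [loadPotential, sub_self, zero_div, sub_zero]
    field_simp
  · have hev : loadPotential L k s₀ =ᶠ[𝓝 s] fun x => (x - s₀) / (L * (L + k * (x - s₀))) := by
      filter_upwards [lt_mem_nhds hs] with x hx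
      simp [loadPotential, loadFloor, max_eq_left (sub_nonneg.2 hx.le)]
    have hLs : loadFloor L k s₀ s = L + k * (s - s₀) := by
      simp [loadFloor, max_eq_left (sub_nonneg.2 hs.le)]
    have hne : L + k * (s - s₀) ≠ 0 := hLs ▸ (hpos s).ne'
    have h1 : HasDerivAt (fun x => x - s₀) 1 s := (hasDerivAt_id s).sub_const s₀
    have hd := h1.div (((h1.const_mul k).const_add L).const_mul L) (mul_ne_zero hL.ne' hne)
    refine (hd.congr_of_eventuallyEq hev).congr_deriv ?_
    rw [hLs]
    field_simp
    ring

variable {F h r : ℝ → ℝ} {w a b : ℝ}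

lemma intervalIntegrable_neg_deriv_div_sq (hF : ContDiff ℝ 1 F) {g : ℝ → ℝ} (hg : Continuous g)
    (hpos : ∀ x ∈ Icc a b, 0 < g x) (hab : a ≤ b) :
    IntervalIntegrable (fun x => 1 / (g x * g x) * -deriv F x) volume a b := by
  refine ContinuousOn.intervalIntegrable ?_
  rw [uIcc_of_le hab]
  exact (continuousOn_const.div (hg.mul hg).continuousOn
    fun x hx => (mul_pos (hpos x hx) (hpos x hx)).ne').mul
    (hF.continuous_deriv le_rfl).neg.continuousOn

lemma integral_loadFloor (hL : 0 < L) (hk : 0 ≤ k) (hF : ContDiff ℝ 1 F) (hab : a ≤ b) :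
    ∫ x in a..b, 1 / (loadFloor L k s₀ (F x) * loadFloor L k s₀ (F x)) * -deriv F x =
      loadPotential L k s₀ (F a) - loadPotential L k s₀ (F b) := by
  rw [intervalIntegral.integral_eq_sub_of_hasDerivAt
    (f := fun x => -loadPotential L k s₀ (F x))]
  · ring
  · intro x _
    have hd := (hF.differentiable one_ne_zero x).hasDerivAt
    refine ((hasDerivAt_loadPotential hL hk (F x)).comp x hd).neg.congr_deriv ?_
    rw [sq]
    ring
  · exact intervalIntegrable_neg_deriv_div_sq hF
      (continuous_loadFloor.comp hF.continuous) (fun x _ => loadFloor_pos hL hk _) hab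

/-- The ratio integral over a single hill or valley is bounded by the drop of the potential. -/
lemma integral_hill_or_valley_le (hr : ContinuousOn r (Icc 0 w)) (hF : ContDiff ℝ 1 F)
    (hF_anti : Antitone F) (hh : Continuous h) (hh_pos : ∀ x, 0 ≤ x → 0 < h x) (hL : 0 < L)
    (hk : 0 ≤ k) (hab : a < b) (hbw : b ≤ w) (ha : IsHillAge r a) (hb : IsHillAge r b)
    (hfloor : ∀ x, IsHillAge r x → a ≤ x → x ≤ b → loadFloor L k s₀ (F x) ≤ h x)
    (halt : (∀ x ∈ Ioc a b, IsHillSize r x) ∨ (∀ x ∈ Ioo a b, ¬ IsHillSize r x)) :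
    IntervalIntegrable (fun x => 1 / (h (prevHill r x) * h (nextHill r x)) * -deriv F x)
        volume a b ∧
      ∫ x in a..b, 1 / (h (prevHill r x) * h (nextHill r x)) * -deriv F x ≤
        loadPotential L k s₀ (F a) - loadPotential L k s₀ (F b) := by
  have hpos := loadFloor_pos (s₀ := s₀) hL hk
  have hderiv : ∀ x, 0 ≤ -deriv F x := fun x => neg_nonneg.2 hF_anti.deriv_nonpos
  rcases halt with hhill | hvalley
  · have heq : ∀ x ∈ Ioc a b, 1 / (h x * h x) * -deriv F x =
        1 / (h (prevHill r x) * h (nextHill r x)) * -deriv F x := by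
      intro x hx
      rw [(hhill x hx).1, (hhill x hx).2]
    have hint : IntervalIntegrable (fun x => 1 / (h x * h x) * -deriv F x) volume a b :=
      intervalIntegrable_neg_deriv_div_sq hF hh (fun x hx => hh_pos x (ha.1.trans hx.1)) hab.le
    refine ⟨hint.congr (by rwa [uIoc_of_le hab.le]), ?_⟩
    rw [← integral_loadFloor hL hk hF hab.le,
      ← intervalIntegral.integral_congr_Ioo_of_le hab.le
        fun x hx => heq x (Ioo_subset_Ioc_self hx)]
    refine intervalIntegral.integral_mono_on_of_le_Ioo hab.le hint
      (intervalIntegrable_neg_deriv_div_sq hF (continuous_loadFloor.comp hF.continuous)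
        (fun x _ => hpos _) hab.le) fun x hx => ?_
    have hx0 : 0 ≤ x := ha.1.trans hx.1.le
    have hle := hfloor x ((hhill x ⟨hx.1, hx.2.le⟩).isHillAge hx0 hx.2.le hb) hx.1.le hx.2.le
    have hpx := hpos (F x)
    exact mul_le_mul_of_nonneg_right
      (one_div_le_one_div_of_le (mul_pos hpx hpx) (mul_self_le_mul_self hpx.le hle)) (hderiv x)
  · have hgap : ∀ x ∈ Ioo a b, ¬ IsHillAge r x := fun x hx =>
      not_isHillAge_of_no_hillSize hr ha.1 hbw hvalley hx
    have heq : ∀ x ∈ Ioo a b, 1 / (h a * h b) * -deriv F x =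
        1 / (h (prevHill r x) * h (nextHill r x)) * -deriv F x := by
      intro x hx
      rw [prevHill_eq_of_gap ha hgap hx, nextHill_eq_of_gap hb hgap hx]
    have hcont : Continuous (deriv F) := hF.continuous_deriv le_rfl
    have hint : IntervalIntegrable (fun x => 1 / (h a * h b) * -deriv F x) volume a b :=
      (continuous_const.mul hcont.neg).intervalIntegrable a b
    refine ⟨hint.congr_uIoo (by rwa [uIoo_of_le hab.le]), ?_⟩
    rw [← intervalIntegral.integral_congr_Ioo_of_le hab.le heq,
      intervalIntegral.integral_const_mul, intervalIntegral.integral_neg,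
      intervalIntegral.integral_deriv_eq_sub (fun x _ => hF.differentiable one_ne_zero x)
        (hcont.intervalIntegrable a b)]
    refine le_trans ?_ (loadPotential_secant hL hk (hF_anti hab.le))
    rw [neg_sub, one_div_mul_eq_div, mul_comm (loadFloor L k s₀ (F b))]
    exact div_le_div_of_nonneg_left (sub_nonneg.2 (hF_anti hab.le))
      (mul_pos (hpos _) (hpos _)) (mul_le_mul (hfloor a ha le_rfl hab.le)
        (hfloor b hb hab.le le_rfl) (hpos _).le (hh_pos a ha.1).le)

end Potential

lemma sqrt_ratio_bound {c L M : ℝ} (hc : 0 < c) (hcL : c < L) (hLM : L ≤ M) (hM : M ≤ 1) :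
    (L - c) * (M - L) / (L * (M - c)) ≤ 2 / (1 + √c) - 1 := by
  obtain ⟨x, hx, rfl⟩ : ∃ x, 0 < x ∧ c = x ^ 2 :=
    ⟨√c, Real.sqrt_pos.2 hc, (Real.sq_sqrt hc.le).symm⟩
  rw [Real.sqrt_sq hx.le]
  have hL : 0 < L := hc.trans hcL
  have h1 : (M - L) * (1 - x ^ 2) ≤ (1 - L) * (M - x ^ 2) := by nlinarith
  have h2 : (L - x ^ 2) * (1 - L) ≤ L * (1 - x) ^ 2 := by nlinarith [sq_nonneg (L - x)]
  have hx1 : 0 < 1 - x ^ 2 := by linarith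
  have h3 : 2 / (1 + x) - 1 = (1 - x) ^ 2 / (1 - x ^ 2) := by
    rw [div_sub_one (by positivity), div_eq_div_iff (by positivity) hx1.ne']
    ring
  have hMc : 0 < M - x ^ 2 := by linarith
  rw [h3, div_le_div_iff₀ (mul_pos hL hMc) hx1]
  calc (L - x ^ 2) * (M - L) * (1 - x ^ 2) = (L - x ^ 2) * ((M - L) * (1 - x ^ 2)) := by ring
    _ ≤ (L - x ^ 2) * ((1 - L) * (M - x ^ 2)) := by gcongr
    _ = (L - x ^ 2) * (1 - L) * (M - x ^ 2) := by ring
    _ ≤ L * (1 - x) ^ 2 * (M - x ^ 2) := by gcongr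
    _ = (1 - x) ^ 2 * (L * (M - x ^ 2)) := by ring

/-- the per-valley waiting-time ratio bound, in integral form, for
hill ages `u < v` of the SERPT rank function. -/
theorem stmt4
    (F : ℝ → ℝ) (lam rho : ℝ) (h : ℝ → ℝ)
    (hF_diff : ContDiff ℝ 1 F)
    (hF_anti : Antitone F)
    (hF_nonneg : ∀ t, 0 ≤ F t)
    (hF_le_one : ∀ t, F t ≤ 1)
    (hF_int : IntegrableOn F (Ioi 0))
    (hmean_pos : 0 < ∫ t in Ioi (0:ℝ), F t)
    (hlam : 0 < lam)
    (hrho_def : rho = lam * ∫ t in Ioi (0:ℝ), F t)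
    (hrho_lt : rho < 1)
    (hh_def : ∀ a, h a = 1 - lam * ∫ t in (0:ℝ)..a, F t)
    (u v : ℝ) (hu : 0 ≤ u) (huv : u < v) (hFv : 0 < F v)
    (hhu : IsHillAge (serptRank F) u) (hhv : IsHillAge (serptRank F) v)
    (hdecomp : FiniteHillValleyDecomp (serptRank F) u v) :
    (∫ x in u..v,
        h u * h v / (h (prevHill (serptRank F) x) * h (nextHill (serptRank F) x))
          * (-deriv F x))
      ≤ 2 / (1 + Real.sqrt (1 - rho)) * (F u - F v) := by
  set r := serptRank F
  set G : ℝ → ℝ := fun a => ∫ t in Ioi a, F t with hG_def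
  have hFc : Continuous F := hF_diff.continuous
  have hFi : ∀ a b, IntervalIntegrable F volume a b := fun a b => hFc.intervalIntegrable a b
  have hG : ∀ a, 0 ≤ a → G a = G 0 - ∫ t in (0:ℝ)..a, F t := by
    intro a ha
    have := intervalIntegral.integral_Ioi_sub_Ioi hF_int ha
    simp only [hG_def]
    linarith
  have hrho0 : rho = lam * G 0 := hrho_def
  have hhG : ∀ a, 0 ≤ a → h a = (1 - rho) + lam * G a := by
    intro a ha
    rw [hh_def, hG a ha, hrho0]
    ring
  have hc : 0 < 1 - rho := by linarith
  have hG_nonneg : ∀ a, 0 ≤ G a := fun a => integral_nonneg hF_nonneg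
  have hh_pos : ∀ x, 0 ≤ x → 0 < h x := fun x hx => by
    have := mul_nonneg hlam.le (hG_nonneg x)
    rw [hhG x hx]
    linarith
  have hprim : Continuous fun a => ∫ t in (0:ℝ)..a, F t :=
    intervalIntegral.continuous_primitive hFi 0
  have hh : Continuous h := by
    rw [funext hh_def]
    exact continuous_const.sub (continuous_const.mul hprim)
  have hG_drop : ∀ a b, 0 ≤ a → a ≤ b → F b * (b - a) ≤ G a - G b := by
    intro a b ha hab
    rw [hG a ha, hG b (ha.trans hab), sub_sub_sub_cancel_left,
      intervalIntegral.integral_interval_sub_left (hFi _ _) (hFi _ _)]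
    have := intervalIntegral.integral_mono_on hab (f := fun _ => F b) (by simp) (hFi a b)
      (fun x hx => hF_anti hx.2)
    simpa [mul_comm] using this
  have hG_anti : ∀ a b, 0 ≤ a → a ≤ b → G b ≤ G a := fun a b ha hab => by
    linarith [hG_drop a b ha hab, mul_nonneg (hF_nonneg b) (sub_nonneg.2 hab)]
  obtain ⟨w, hvw, hFw⟩ : ∃ w, v < w ∧ 0 < F w :=
    ((hFc.continuousAt.eventually (lt_mem_nhds hFv)).filter_mono nhdsWithin_le_nhds |>.and
      (self_mem_nhdsWithin : Ioi v ∈ 𝓝[>] v)).exists.imp fun _ hx => ⟨hx.2, hx.1⟩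
  have hv : 0 < v := hu.trans_lt huv
  have hF_pos : ∀ x, x ≤ w → 0 < F x := fun x hx => hFw.trans_le (hF_anti hx)
  have hGr : ∀ x, x ≤ w → G x = r x * F x := fun x hx =>
    (div_mul_cancel₀ (G x) (hF_pos x hx).ne').symm
  have hr : ContinuousOn r (Icc 0 w) := by
    have hc : ContinuousOn (fun a => (G 0 - ∫ t in (0:ℝ)..a, F t) / F a) (Icc 0 w) :=
      (continuous_const.sub hprim).continuousOn.div hFc.continuousOn
        fun x hx => (hF_pos x hx.2).ne'
    refine hc.congr fun x hx => ?_
    beta_reduce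
    rw [← hG x hx.1]
    rfl
  have hGv : 0 < G v := by
    nlinarith [hG_drop v w hv.le hvw.le, hG_nonneg w, mul_pos hFw (sub_pos.2 hvw)]
  have hGuv : G v ≤ G u := hG_anti u v hu huv.le
  have hGu : 0 < G u := hGv.trans_le hGuv
  have hFu : 0 < F u := hF_pos u (huv.le.trans hvw.le)
  have hru : 0 < r u := div_pos hGu hFu
  have hL : 0 < h v := hh_pos v hv.le
  set k := lam * r u with hk_def
  have hk : 0 < k := mul_pos hlam hru
  set s₀ := G v / r u with hs₀_def
  have hs₀ : r u * s₀ = G v := mul_div_cancel₀ _ hru.ne'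
  have hks₀ : k * s₀ = lam * G v := by rw [hk_def, mul_assoc, hs₀]
  have hfloor : ∀ x, IsHillAge r x → u ≤ x → x ≤ v → loadFloor (h v) k s₀ (F x) ≤ h x := by
    intro x hx hux hxv
    have hx0 := hu.trans hux
    have h1 : h v ≤ h x := by
      rw [hhG v hv.le, hhG x hx0]
      linarith [mul_le_mul_of_nonneg_left (hG_anti x v hx0 hxv) hlam.le]
    unfold loadFloor
    rcases le_total (F x - s₀) 0 with hs | hs
    · simpa [max_eq_right hs] using h1
    · rw [max_eq_left hs, hhG v hv.le, hhG x hx0, hGr x (hxv.trans hvw.le), mul_sub, hks₀]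
      have := mul_le_mul_of_nonneg_left (mul_le_mul_of_nonneg_right
        (hhu.rank_mono hr hx hux (hxv.trans_lt hvw)) (hF_nonneg x)) hlam.le
      rw [hk_def, mul_assoc]
      linarith
  obtain ⟨n, p, hp0, hpn, hphill, hplt, halt⟩ := hdecomp
  have hpmono : ∀ i j, i ≤ j → j ≤ n → p i ≤ p j := by
    intro i j hij
    induction j, hij using Nat.le_induction with
    | base => exact fun _ => le_rfl
    | succ j hij ih => exact fun hj => (ih (by omega)).trans (hplt j (by omega)).le
  have hpu : ∀ i ≤ n, u ≤ p i := fun i hi => hp0 ▸ hpmono 0 i (Nat.zero_le i) hi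
  have hpv : ∀ i ≤ n, p i ≤ v := fun i hi => hpn ▸ hpmono i n hi le_rfl
  have hpiece := fun i (hi : i < n) =>
    integral_hill_or_valley_le hr hF_diff hF_anti hh hh_pos hL hk.le (hplt i hi)
      ((hpv (i + 1) hi).trans hvw.le) (hphill i hi.le) (hphill (i + 1) hi)
      (fun x hx hx1 hx2 => hfloor x hx ((hpu i hi.le).trans hx1) (hx2.trans (hpv (i + 1) hi)))
      (halt i hi)
  have htotal : ∫ x in u..v, 1 / (h (prevHill r x) * h (nextHill r x)) * -deriv F x ≤
      loadPotential (h v) k s₀ (F u) - loadPotential (h v) k s₀ (F v) := by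
    nth_rw 1 [← hp0, ← hpn]
    rw [← intervalIntegral.sum_integral_adjacent_intervals
      fun i hi => (hpiece i hi).1]
    have htel := Finset.sum_range_sub' (fun i => loadPotential (h v) k s₀ (F (p i))) n
    rw [hp0, hpn] at htel
    rw [← htel]
    exact Finset.sum_le_sum fun i hi => (hpiece i (Finset.mem_range.1 hi)).2
  have hpull : ∀ x, h u * h v / (h (prevHill r x) * h (nextHill r x)) * -deriv F x =
      h u * h v * (1 / (h (prevHill r x) * h (nextHill r x)) * -deriv F x) := fun x => by ring
  simp_rw [hpull]
  rw [intervalIntegral.integral_const_mul]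
  have hhu_pos : 0 < h u := hh_pos u hu
  refine (mul_le_mul_of_nonneg_left htotal (mul_pos hhu_pos hL).le).trans ?_
  have hs₀u : s₀ ≤ F u := by
    rw [hs₀_def, div_le_iff₀ hru, mul_comm, ← hGr u (huv.le.trans hvw.le)]
    exact hGuv
  have hvs₀ : F v ≤ s₀ := by
    rw [hs₀_def, le_div_iff₀ hru, mul_comm, hGr v hvw.le]
    exact mul_le_mul_of_nonneg_right (hhu.rank_mono hr hhv huv.le hvw) hFv.le
  have hfu : loadFloor (h v) k s₀ (F u) = h u := by
    rw [loadFloor, max_eq_left (sub_nonneg.2 hs₀u), mul_sub, hks₀, hhG u hu, hhG v hv.le,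
      hGr u (huv.le.trans hvw.le), hk_def]
    ring
  have hfv : loadFloor (h v) k s₀ (F v) = h v := by
    rw [loadFloor, max_eq_right (sub_nonpos.2 hvs₀), mul_zero, add_zero]
  have hexact : h u * h v *
      (loadPotential (h v) k s₀ (F u) - loadPotential (h v) k s₀ (F v)) =
      (F u - F v) + (s₀ - F v) * ((h u - h v) / h v) := by
    rw [loadPotential, loadPotential, hfu, hfv]
    field_simp
    ring
  have hratio : (s₀ - F v) * F u ≤ s₀ * (F u - F v) := by nlinarith
  have hfrac : s₀ / F u = (h v - (1 - rho)) / (h u - (1 - rho)) := by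
    rw [hhG u hu, hhG v hv.le, add_sub_cancel_left, add_sub_cancel_left,
      mul_div_mul_left _ _ hlam.ne', hGr u (huv.le.trans hvw.le), ← hs₀,
      mul_div_mul_left _ _ hru.ne']
  have hcv : 1 - rho < h v := by
    rw [hhG v hv.le]
    linarith [mul_pos hlam hGv]
  have hvu : h v ≤ h u := by
    rw [hhG u hu, hhG v hv.le]
    linarith [mul_le_mul_of_nonneg_left hGuv hlam.le]
  have hu1 : h u ≤ 1 := by
    rw [hhG u hu, hrho0]
    linarith [mul_le_mul_of_nonneg_left (hG_anti 0 u le_rfl hu) hlam.le]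
  have hbound := sqrt_ratio_bound hc hcv hvu hu1
  rw [mul_comm (h v) (h u - (1 - rho)), mul_div_mul_comm, ← hfrac] at hbound
  have hFuv : 0 ≤ F u - F v := sub_nonneg.2 (hF_anti huv.le)
  have hexc : 0 ≤ (h u - h v) / h v := div_nonneg (by linarith) hL.le
  have hs : s₀ - F v ≤ s₀ / F u * (F u - F v) := by
    rw [div_mul_eq_mul_div, le_div_iff₀ hFu]
    exact hratio
  rw [hexact]
  have h1 := mul_le_mul_of_nonneg_right hs hexc
  have h2 := mul_le_mul_of_nonneg_right hbound hFuv
  linarith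
end

section
/- Let 0 ≤ y ≤ z with F̄(z) > 0, and suppose h(x)·F̄(z) ≤ F̄(x)·h(z) for all x ∈ [y, z]. Then ∫_y^z F̄(x)/h(y) dx + F̄(z)·z·(1/h(z) − 1/h(y)) ≤ (1/λ)·log(h(y)/h(z)) + F̄(z)·(J(z) − J(y))/(h(y)·h(z)). -/
open MeasureTheory Set

/-- for `0 ≤ y ≤ z` with `F̄(z) > 0` and `h(x)·F̄(z) ≤ F̄(x)·h(z)`
for all `x ∈ [y, z]`,
`∫_y^z F̄(x)/h(y) dx + F̄(z)·z·(1/h(z) − 1/h(y))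
  ≤ (1/λ)·log(h(y)/h(z)) + F̄(z)·(J(z) − J(y))/(h(y)·h(z))`. -/
theorem stmt8
    (F : ℝ → ℝ) (lam rho : ℝ) (h J : ℝ → ℝ)
    (hF_cont : Continuous F)
    (hF_anti : Antitone F)
    (hF_nonneg : ∀ t, 0 ≤ F t)
    (hF_le_one : ∀ t, F t ≤ 1)
    (hF_int : IntegrableOn F (Ioi 0))
    (hmean_pos : 0 < ∫ t in Ioi (0:ℝ), F t)
    (hlam : 0 < lam)
    (hrho_def : rho = lam * ∫ t in Ioi (0:ℝ), F t)
    (hrho_lt : rho < 1)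
    (hh_def : ∀ a, h a = 1 - lam * ∫ t in (0:ℝ)..a, F t)
    (hJ_def : ∀ a, J a = lam * ∫ t in (0:ℝ)..a, t * F t)
    (y z : ℝ) (hy : 0 ≤ y) (hyz : y ≤ z) (hFz : 0 < F z)
    (hkey : ∀ x ∈ Icc y z, h x * F z ≤ F x * h z) :
    (∫ x in y..z, F x / h y) + F z * z * (1 / h z - 1 / h y)
      ≤ (1 / lam) * Real.log (h y / h z) + F z * (J z - J y) / (h y * h z) := by
  have hFi : ∀ a b, IntervalIntegrable F volume a b := fun a b => hF_cont.intervalIntegrable a b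
  have hpos : ∀ a, 0 ≤ a → 0 < h a := by
    intro a ha
    have hle : ∫ t in (0:ℝ)..a, F t ≤ ∫ t in Ioi (0:ℝ), F t := by
      rw [intervalIntegral.integral_of_le ha]
      exact setIntegral_mono_set hF_int (Filter.Eventually.of_forall hF_nonneg)
        Ioc_subset_Ioi_self.eventuallyLE
    rw [hh_def]
    nlinarith [mul_le_mul_of_nonneg_left hle hlam.le]
  have hh' : ∀ x, HasDerivAt h (-(lam * F x)) x := by
    intro x
    rw [funext hh_def]
    exact ((hF_cont.integral_hasStrictDerivAt 0 x).hasDerivAt.const_mul lam).const_sub 1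
  have hJ' : ∀ x, HasDerivAt J (lam * (x * F x)) x := by
    intro x
    rw [funext hJ_def]
    exact ((continuous_id.mul hF_cont).integral_hasStrictDerivAt 0 x).hasDerivAt.const_mul lam
  have hz : 0 ≤ z := hy.trans hyz
  have hH : 0 < h y := hpos y hy
  have hK : 0 < h z := hpos z hz
  have hpos' : ∀ x ∈ Icc y z, 0 < h x := fun x hx => hpos x (hy.trans hx.1)
  -- Integrating the hypothesis over `[x, z]` bounds `log (h x / h z)` from below.
  have hlog : ∀ x ∈ Icc y z,
      F z * lam * (z - x) / h z ≤ Real.log (h x) - Real.log (h z) := by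
    have hD : ∀ x ∈ Icc y z, HasDerivAt (fun x => Real.log (h x) + F z * lam / h z * x)
        (-(lam * F x) / h x + F z * lam / h z * 1) x := fun x hx =>
      ((hh' x).log (hpos' x hx).ne').add ((hasDerivAt_id x).const_mul _)
    have hanti := antitoneOn_of_hasDerivWithinAt_nonpos (convex_Icc y z)
      (fun x hx => (hD x hx).continuousAt.continuousWithinAt)
      (fun x hx => (hD x (interior_subset hx)).hasDerivWithinAt)
      (by
        intro x hx
        have hx' := interior_subset hx
        have hle : F z / h z ≤ F x / h x := by
          rw [div_le_div_iff₀ hK (hpos' x hx')]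
          linarith [hkey x hx']
        have := mul_le_mul_of_nonneg_left hle hlam.le
        calc _ = lam * (F z / h z) - lam * (F x / h x) := by ring
          _ ≤ 0 := by linarith)
    intro x hx
    have hle := hanti hx (right_mem_Icc.2 hyz) hx.2
    have e : F z * lam * (z - x) / h z = F z * lam / h z * z - F z * lam / h z * x := by ring
    simp only at hle
    linarith
  have hE : ∀ x ∈ Icc y z, HasDerivAt
      (fun x => F z * lam / h z * (-z * h x - J x) + (h x * Real.log (h x) - h x - Real.log (h z) * h x))
      (F z * lam / h z * (-z * -(lam * F x) - lam * (x * F x)) +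
        ((-(lam * F x) * Real.log (h x) + h x * (-(lam * F x) / h x)) - -(lam * F x)
          - Real.log (h z) * -(lam * F x))) x := fun x hx =>
    ((((hh' x).const_mul (-z)).sub (hJ' x)).const_mul _).add
      ((((hh' x).mul ((hh' x).log (hpos' x hx).ne')).sub (hh' x)).sub ((hh' x).const_mul _))
  have hanti := antitoneOn_of_hasDerivWithinAt_nonpos (convex_Icc y z)
    (fun x hx => (hE x hx).continuousAt.continuousWithinAt)
    (fun x hx => (hE x (interior_subset hx)).hasDerivWithinAt)
    (by
      intro x hx
      have hx' := interior_subset hx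
      have := mul_le_mul_of_nonneg_left (hlog x hx') (mul_nonneg hlam.le (hF_nonneg x))
      rw [mul_div_cancel₀ _ (hpos' x hx').ne']
      calc _ = lam * F x * (F z * lam * (z - x) / h z)
            - lam * F x * (Real.log (h x) - Real.log (h z)) := by ring
        _ ≤ 0 := by linarith)
  have hle := hanti (left_mem_Icc.2 hyz) (right_mem_Icc.2 hyz) hyz
  simp only at hle
  have integral_eq : ∫ x in y..z, F x / h y = (h y - h z) / lam / h y := by
    rw [intervalIntegral.integral_div, hh_def y, hh_def z,
      ← intervalIntegral.integral_interval_sub_left (hFi 0 z) (hFi 0 y)]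
    field_simp
    ring
  rw [integral_eq, Real.log_div hH.ne' hK.ne']
  rw [← sub_nonneg] at hle ⊢
  refine (div_nonneg hle (mul_pos hlam hH).le).trans_eq ?_
  field_simp
  ring
end

section
/- Let g_u, g_y, g_x, g_z, g_v be real numbers with 0 < g_v ≤ g_z ≤ g_x ≤ g_y ≤ g_u and g_v < g_u. Then (g_u/(g_u − g_v)) · ( g_x/g_y − g_x/g_u + 1 − g_z/g_y + g_z/g_x − g_v/g_x ) ≤ 2/(1 + √(g_v/g_u)). Moreover, if g_v/g_u ≥ 1 − ρ for some ρ ∈ [0,1), the right-hand side is at most 2/(1 + √(1−ρ)). -/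
/-- the concluding algebraic optimization inequality in the proof of
the M-SERPT waiting-time bound. For `0 < g_v ≤ g_z ≤ g_x ≤ g_y ≤ g_u` with `g_v < g_u`,
`(g_u/(g_u − g_v))·(g_x/g_y − g_x/g_u + 1 − g_z/g_y + g_z/g_x − g_v/g_x)
  ≤ 2/(1 + √(g_v/g_u))`, and if moreover `g_v/g_u ≥ 1 − ρ` for some `ρ ∈ [0,1)`, then
`2/(1 + √(g_v/g_u)) ≤ 2/(1 + √(1 − ρ))`. -/
theorem stmt12
    (gu gy gx gz gv : ℝ)
    (hv_pos : 0 < gv) (hvz : gv ≤ gz) (hzx : gz ≤ gx) (hxy : gx ≤ gy) (hyu : gy ≤ gu)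
    (hvu : gv < gu) :
    gu / (gu - gv) * (gx / gy - gx / gu + 1 - gz / gy + gz / gx - gv / gx)
      ≤ 2 / (1 + Real.sqrt (gv / gu)) ∧
    ∀ rho : ℝ, 0 ≤ rho → rho < 1 → 1 - rho ≤ gv / gu →
      2 / (1 + Real.sqrt (gv / gu)) ≤ 2 / (1 + Real.sqrt (1 - rho)) := by
  have hu : 0 < gu := hv_pos.trans hvu
  have hx : 0 < gx := hv_pos.trans_le (hvz.trans hzx)
  refine ⟨?_, fun rho _ _ h => by gcongr⟩
  set s := Real.sqrt (gv / gu) with hs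
  have hs0 : 0 ≤ s := Real.sqrt_nonneg _
  have hv : gv = s ^ 2 * gu := by
    rw [hs, Real.sq_sqrt (by positivity), div_mul_cancel₀ _ hu.ne']
  have hs1 : s < 1 := by
    rw [hs, Real.sqrt_lt' one_pos, one_pow]
    exact (div_lt_one hu).2 hvu
  have h_ratio : (gx - gz) / gy ≤ (gx - gz) / gx :=
    div_le_div_of_nonneg_left (sub_nonneg.2 hzx) hx hxy
  have h_amgm : 2 * s ≤ gx / gu + gv / gx := by
    have h : gx / gu + gv / gx - 2 * s = (gx - s * gu) ^ 2 / (gu * gx) := by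
      rw [hv]
      field_simp
      ring
    have : 0 ≤ (gx - s * gu) ^ 2 / (gu * gx) := by positivity
    linarith
  have h_bracket :
      gx / gy - gx / gu + 1 - gz / gy + gz / gx - gv / gx ≤ 2 * (1 - s) := by
    rw [sub_div, sub_div, div_self hx.ne'] at h_ratio
    linarith
  have h_factor : 0 ≤ gu / (gu - gv) := div_nonneg hu.le (sub_pos.2 hvu).le
  refine (mul_le_mul_of_nonneg_left h_bracket h_factor).trans_eq ?_
  have h_sub : gu - gv = gu * ((1 - s) * (1 + s)) := by rw [hv]; ring
  have h1 : 1 - s ≠ 0 := (sub_pos.2 hs1).ne'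
  have h2 : 1 + s ≠ 0 := by positivity
  rw [h_sub]
  field_simp
end

section
/- Let ρ ∈ (0,1), c = 2/(1 + √(1−ρ)), and κ = (1/ρ)·log(1/(1−ρ)). Let W_M, R_M, W_G, R_G, m be nonnegative reals with W_G + R_G > 0, and suppose W_M ≤ c·W_G, R_M ≤ W_M + κ·m, m ≤ R_G, and κ·m ≤ W_G + R_G. Then (W_M + R_M)/(W_G + R_G) ≤ min{ max{2c, κ}, 1 + 2c } = min{ max{ 4/(1+√(1−ρ)), (1/ρ)·log(1/(1−ρ)) }, 1 + 4/(1+√(1−ρ)) }. -/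
/-- the abstract algebraic combination step of the main
approximation-ratio theorem. -/
theorem stmt13
    (rho c kappa WM RM WG RG m : ℝ)
    (hrho0 : 0 < rho) (hrho1 : rho < 1)
    (hc : c = 2 / (1 + Real.sqrt (1 - rho)))
    (hkappa : kappa = (1 / rho) * Real.log (1 / (1 - rho)))
    (hWM : 0 ≤ WM) (hRM : 0 ≤ RM) (hWG : 0 ≤ WG) (hRG : 0 ≤ RG) (hm : 0 ≤ m)
    (hpos : 0 < WG + RG)
    (hwait : WM ≤ c * WG)
    (hres : RM ≤ WM + kappa * m)
    (hsize : m ≤ RG)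
    (hsrpt : kappa * m ≤ WG + RG) :
    (WM + RM) / (WG + RG) ≤ min (max (2 * c) kappa) (1 + 2 * c) ∧
    min (max (2 * c) kappa) (1 + 2 * c)
      = min
          (max (4 / (1 + Real.sqrt (1 - rho)))
            ((1 / rho) * Real.log (1 / (1 - rho))))
          (1 + 4 / (1 + Real.sqrt (1 - rho))) := by
  have hc0 : 0 ≤ c := by rw [hc]; positivity
  have hk0 : 0 ≤ kappa := by
    have hlog : 0 ≤ Real.log (1 / (1 - rho)) :=
      Real.log_nonneg ((one_le_div (by linarith)).mpr (by linarith))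
    rw [hkappa]
    positivity
  have h2c : 2 * c = 4 / (1 + Real.sqrt (1 - rho)) := by rw [hc]; ring
  refine ⟨le_min ?_ ?_, by rw [← h2c, ← hkappa]⟩
  · rw [div_le_iff₀ hpos]
    have h1 : kappa * m ≤ kappa * RG := mul_le_mul_of_nonneg_left hsize hk0
    have h2 : 2 * c * WG ≤ max (2 * c) kappa * WG :=
      mul_le_mul_of_nonneg_right (le_max_left _ _) hWG
    have h3 : kappa * RG ≤ max (2 * c) kappa * RG :=
      mul_le_mul_of_nonneg_right (le_max_right _ _) hRG
    linarith
  · rw [div_le_iff₀ hpos]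
    have h : 0 ≤ c * RG := mul_nonneg hc0 hRG
    linarith
end

section
/- Let a ≥ 0 with F̄(a) > 0, and suppose F̄ is differentiable at a with F̄′(a) = −f(a) where f(a) > 0. Then lim_{b → a⁺} η(a,b) = F̄(a)/f(a); that is, the efficiency function extends continuously to the diagonal with value equal to the reciprocal of the hazard rate at a. -/
open MeasureTheory Set Filter

/-- if `F̄(a) > 0` and `F̄` is differentiable at `a` with
`F̄′(a) = −f(a)`, `f(a) > 0`, then `η(a,b) → F̄(a)/f(a)` as `b → a⁺`; i.e., the
efficiency function extends continuously to the diagonal with value equal to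
the reciprocal of the hazard rate. -/
theorem stmt16
    (F : ℝ → ℝ)
    (hF_cont : Continuous F)
    (hF_anti : Antitone F)
    (hF_nonneg : ∀ t, 0 ≤ F t)
    (hF_le_one : ∀ t, F t ≤ 1)
    (a fa : ℝ) (ha : 0 ≤ a) (hFa : 0 < F a)
    (hderiv : HasDerivAt F (-fa) a) (hfa : 0 < fa) :
    Tendsto (fun b => (∫ t in a..b, F t) / (F a - F b))
      (nhdsWithin a (Ioi a)) (nhds (F a / fa)) := by
  have h_int : HasDerivAt (fun b => ∫ t in a..b, F t) (F a) a :=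
    intervalIntegral.integral_hasDerivAt_right (hF_cont.intervalIntegrable a a)
      (hF_cont.stronglyMeasurableAtFilter _ _) hF_cont.continuousAt
  have h_le : nhdsWithin a (Ioi a) ≤ nhdsWithin a {a}ᶜ :=
    nhdsWithin_mono a fun _ hx => ne_of_gt hx
  have h_num := (hasDerivAt_iff_tendsto_slope.mp h_int).mono_left h_le
  have h_den := ((hasDerivAt_iff_tendsto_slope.mp hderiv).mono_left h_le).neg
  rw [neg_neg] at h_den
  refine (h_num.div h_den hfa.ne').congr' ?_
  filter_upwards [self_mem_nhdsWithin] with b hb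
  have hba : b - a ≠ 0 := (sub_pos.mpr hb).ne'
  simp only [Pi.div_apply, slope_def_field, intervalIntegral.integral_same, sub_zero]
  rw [← neg_div, neg_sub, div_div_div_cancel_right₀ hba]
end
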